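/- For every β > 1, every k ≥ 1, and every vertex z on the main part of an order-k branch of the fractal configuration ξ lying at least 3·2^{k−1} steps to the left of the corner of that branch, the β-biased random walk started at z on ξ never returns to z with probability at least (β−1)/(2(3+β)). -/

import Mathlib

open MeasureTheory Filter
open scoped ENNReal

noncomputable section

/-- Vertices of the square lattice. -/
abbrev V : Type := ℤ × ℤ

/-- Adjacency in the square lattice ℤ²: Euclidean distance one. -/
def latAdj (u v : V) : Prop := (u.1 - v.1) ^ 2 + (u.2 - v.2) ^ 2 = 1

instance : MeasurableSpace (Sym2 V) := ⊤

open scoped Classical in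
/-- One-step transition probability of the β-biased random walk on the subgraph of ℤ²
with edge set `G`: if the set `Λ` of neighbours of `z` is nonempty and contains the right
neighbour `(z.1+1, z.2)`, step to it with probability `β/(β+|Λ|-1)` and to each other
neighbour with probability `1/(β+|Λ|-1)`; if `Λ` does not contain the right neighbour, step
uniformly in `Λ`; if `Λ` is empty, stay put. -/
def transProb (β : ℝ) (G : Set (Sym2 V)) (z w : V) : ℝ :=
  if {u : V | s(z, u) ∈ G} = ∅ then (if w = z then 1 else 0)
  else
    if s(z, w) ∈ G then
      (if s(z, ((z.1 + 1, z.2) : V)) ∈ G then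
        (if w = ((z.1 + 1, z.2) : V) then
          β / (β + ({u : V | s(z, u) ∈ G}.ncard : ℝ) - 1)
        else 1 / (β + ({u : V | s(z, u) ∈ G}.ncard : ℝ) - 1))
      else 1 / ({u : V | s(z, u) ∈ G}.ncard : ℝ))
    else 0

/-- `μ` is the law of the β-biased random walk on the subgraph of ℤ² with edge set `G`,
started at `z₀`: a probability measure on trajectories whose cylinder probabilities are
the products of the one-step transition probabilities. -/
def IsWalkLaw (β : ℝ) (G : Set (Sym2 V)) (z₀ : V) (μ : Measure (ℕ → V)) : Prop :=
  IsProbabilityMeasure μ ∧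
    ∀ (n : ℕ) (f : ℕ → V), f 0 = z₀ →
      μ {ω | ∀ i ≤ n, ω i = f i} =
        ENNReal.ofReal (∏ i ∈ Finset.range n, transProb β G (f i) (f (i + 1)))

/-- `b_k = 4 · 3^{k(k-1)/2}`. -/
def bF (k : ℕ) : ℕ := 4 * 3 ^ (k * (k - 1) / 2)

/-- `q_k = 3^k - 1`. -/
def qF (k : ℕ) : ℕ := 3 ^ k - 1

open scoped Classical in
/-- Direction of the abutment of a branch on row index `l` (odd): `+1` if `(l+1)/2` is odd
(so that the root lands on a row reserved for branches of the next order), `-1` otherwise. -/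
def dirF (l : ℤ) : ℤ := if Odd ((l + 1) / 2) then 1 else -1

/-- The set of x-coordinates of tips of order-`k` branches of the fractal configuration:
`0` is a tip of every order, and if `x` is an order-`(k+1)` tip then `x + (j-1)·b_k` is an
order-`k` tip for every `1 ≤ j ≤ q_k` (the order-`k` branches attached to the order-`(k+1)`
branch with tip `x` have their roots at `x + j·b_k - 1`, hence their tips at `x + (j-1)·b_k`). -/
inductive IsTip : ℕ → ℤ → Prop
  | zero (k : ℕ) : IsTip k 0
  | step (k : ℕ) (x : ℤ) (j : ℕ) : IsTip (k + 1) x → 1 ≤ j → j ≤ qF k →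
      IsTip k (x + ((j : ℤ) - 1) * (bF k : ℤ))

/-- The y-coordinate of the row with index `l` reserved for order-`k` branches:
`y = 3 · 2^{k-1} · l` (`l` odd). -/
def rowY (k : ℕ) (l : ℤ) : ℤ := 3 * 2 ^ (k - 1) * l

/-- The fractal configuration ξ: for every order `k ≥ 1`, every odd `l` and every order-`k`
tip `x`, the main part of the branch (the `b_k - 1` horizontal edges from the tip
`(x, 3·2^{k-1}·l)` to the corner `(x + b_k - 1, 3·2^{k-1}·l)`) together with its abutment
(the `3·2^{k-1}` vertical edges from the corner to the root, in the direction `dirF l`). -/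
def xiEdges : Set (Sym2 V) :=
  {f | ∃ (k : ℕ) (l x : ℤ), 1 ≤ k ∧ Odd l ∧ IsTip k x ∧
    ((∃ i : ℕ, i + 2 ≤ bF k ∧
        f = s((x + i, rowY k l), (x + i + 1, rowY k l))) ∨
      (∃ j : ℕ, j < 3 * 2 ^ (k - 1) ∧
        f = s((x + bF k - 1, rowY k l + dirF l * j),
              (x + bF k - 1, rowY k l + dirF l * (j + 1)))))}

/-- `z` lies on the main part of the order-`k` branch with row index `l` and tip
x-coordinate `x`. -/
def OnMainPart (k : ℕ) (l x : ℤ) (z : V) : Prop :=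
  z.2 = rowY k l ∧ x ≤ z.1 ∧ z.1 ≤ x + bF k - 1


section Arithmetic

lemma bF_succ (k : ℕ) : bF (k + 1) = 3 ^ k * bF k := by
  have h : (k + 1) * (k + 1 - 1) / 2 = k + k * (k - 1) / 2 := by
    have h1 : (k + 1) * (k + 1 - 1) = k * (k - 1) + k * 2 := by
      cases k with
      | zero => rfl
      | succ n => simp only [Nat.add_sub_cancel]; ring
    rw [h1, Nat.add_mul_div_right _ _ (by norm_num)]
    ring
  rw [bF, bF, h, pow_add]
  ring

lemma bF_pos (k : ℕ) : 0 < bF k := by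
  unfold bF
  positivity

lemma four_le_bF (k : ℕ) : 4 ≤ bF k :=
  Nat.le_mul_of_pos_right _ (by positivity)

lemma bF_dvd {k m : ℕ} (h : k ≤ m) : bF k ∣ bF m := by
  induction m, h using Nat.le_induction with
  | base => exact dvd_rfl
  | succ m _ ih => exact ih.trans (bF_succ m ▸ dvd_mul_left _ _)

lemma three_mul_two_pow_le_bF {k : ℕ} (hk : 3 ≤ k) : 3 * 2 ^ k + 2 ≤ bF k := by
  induction k, hk using Nat.le_induction with
  | base => norm_num [bF]
  | succ k hk ih =>
    have h3 : 3 ^ 1 ≤ 3 ^ k := Nat.pow_le_pow_right (by norm_num) (by omega)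
    have := Nat.mul_le_mul_right (bF k) h3
    rw [bF_succ, pow_succ]
    omega

lemma IsTip.bF_dvd {k : ℕ} {x : ℤ} (h : IsTip k x) : (bF k : ℤ) ∣ x := by
  induction h with
  | zero k => exact dvd_zero _
  | step k x j _ _ _ ih =>
    refine dvd_add (dvd_trans ?_ ih) (dvd_mul_left _ _)
    exact_mod_cast _root_.bF_dvd (Nat.le_succ k)

/-- Every tip is obtained from a tip of the next order. -/
lemma IsTip.exists_parent {k : ℕ} {x : ℤ} (hk : 1 ≤ k) (h : IsTip k x) :
    ∃ (x' : ℤ) (j : ℕ), IsTip (k + 1) x' ∧ 1 ≤ j ∧ j ≤ qF k ∧ x + bF k = x' + j * bF k := by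
  cases h with
  | zero =>
    refine ⟨0, 1, IsTip.zero _, le_rfl, ?_, by simp⟩
    have h3 : 3 ^ 1 ≤ 3 ^ k := Nat.pow_le_pow_right (by norm_num) hk
    unfold qF
    omega
  | step _ x' j hx' h1 h2 => exact ⟨x', j, hx', h1, h2, by ring⟩

lemma mul_bF_add_le {k j : ℕ} (h : j ≤ qF k) : j * bF k + bF k ≤ bF (k + 1) := by
  have h3 : 0 < 3 ^ k := by positivity
  have : j + 1 ≤ 3 ^ k := by unfold qF at h; omega
  calc j * bF k + bF k = (j + 1) * bF k := by ring
    _ ≤ bF (k + 1) := bF_succ k ▸ Nat.mul_le_mul_right _ this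

/-- The corner of a branch is not in the same column as the corner of a branch of higher order. -/
lemma IsTip.not_dvd {k m : ℕ} {x : ℤ} (hk : 1 ≤ k) (hkm : k < m) (h : IsTip k x) :
    ¬ (bF m : ℤ) ∣ x + bF k := by
  intro hd
  obtain ⟨x', j, hx', h1, h2, he⟩ := h.exists_parent hk
  have hd' : (bF (k + 1) : ℤ) ∣ x' + j * bF k :=
    he ▸ dvd_trans (by exact_mod_cast _root_.bF_dvd (Nat.succ_le_of_lt hkm)) hd
  have hj : bF (k + 1) ∣ j * bF k := by
    exact_mod_cast (dvd_add_right hx'.bF_dvd).1 hd'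
  have hb := bF_pos k
  have := Nat.le_of_dvd (by positivity) hj
  have := mul_bF_add_le h2
  omega

lemma dirF_eq (l : ℤ) : dirF l = 1 ∨ dirF l = -1 := by
  unfold dirF
  split_ifs <;> simp

lemma exists_odd_of_dirF {l : ℤ} (hl : Odd l) : ∃ l' : ℤ, Odd l' ∧ l + dirF l = 2 * l' := by
  obtain ⟨a, rfl⟩ := hl
  unfold dirF
  have h : (2 * a + 1 + 1) / 2 = a + 1 := by omega
  rw [h]
  split_ifs with ho
  · exact ⟨a + 1, ho, by ring⟩
  · refine ⟨a, ?_, by ring⟩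
    rcases Int.even_or_odd a with he | ho'
    · exact absurd he.add_one ho
    · exact ho'

lemma rowY_root {k : ℕ} {l l' : ℤ} (hk : 1 ≤ k) (h : l + dirF l = 2 * l') :
    rowY k l + dirF l * (3 * 2 ^ (k - 1) : ℕ) = rowY (k + 1) l' := by
  obtain ⟨m, rfl⟩ := Nat.exists_eq_add_of_le' hk
  unfold rowY
  push_cast [Nat.add_sub_cancel]
  have : (3 * 2 ^ m : ℤ) * (l + dirF l) = 3 * 2 ^ m * (2 * l') := by rw [h]
  rw [pow_succ]
  linear_combination this

/-- An abutment of order `k`, root excluded, meets only rows of order at most `k`. -/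
lemma order_le_of_rowY {k k' : ℕ} {l l' : ℤ} {j : ℕ} (hk : 1 ≤ k) (hl : Odd l)
    (hj : j < 3 * 2 ^ (k - 1)) (h : rowY k l + dirF l * j = rowY k' l') : k' ≤ k := by
  by_contra! hlt
  obtain ⟨m, rfl⟩ := Nat.exists_eq_add_of_le' hk
  obtain ⟨p, rfl⟩ := Nat.exists_eq_add_of_lt hlt
  simp only [rowY, Nat.add_sub_cancel] at h hj
  set A : ℤ := 3 * 2 ^ m with hA
  have h3 : (3 : ℤ) * 2 ^ (m + 1 + p) = A * (2 * 2 ^ p) := by rw [hA]; ring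
  rw [h3] at h
  have hA0 : 0 < A := by positivity
  have hjA : (j : ℤ) < A := by rw [hA]; exact_mod_cast hj
  have hdvd : A ∣ j := by
    have h4 : A ∣ dirF l * j := ⟨2 * 2 ^ p * l' - l, by linear_combination h⟩
    rcases dirF_eq l with hd | hd <;> rw [hd] at h4 <;> simpa using h4
  have hj0 : (j : ℤ) = 0 := Int.eq_zero_of_dvd_of_nonneg_of_lt (by positivity) hjA hdvd
  rw [hj0, mul_zero, add_zero] at h
  have h5 := mul_left_cancel₀ hA0.ne' (h.trans (mul_assoc A _ l'))
  obtain ⟨a, rfl⟩ := hl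
  have : (2 * a + 1 : ℤ) = 2 * (2 ^ p * l') := by rw [h5]; ring
  omega

lemma rowY_abutment_inj {k : ℕ} {l l' : ℤ} {j j' : ℕ} (hl : Odd l) (hl' : Odd l')
    (hj : j < 3 * 2 ^ (k - 1)) (hj' : j' < 3 * 2 ^ (k - 1))
    (h : rowY k l + dirF l * j = rowY k l' + dirF l' * j') : l = l' := by
  simp only [rowY] at h
  set A : ℤ := 3 * 2 ^ (k - 1) with hA
  have hjA : (j : ℤ) < A := by rw [hA]; exact_mod_cast hj
  have hjA' : (j' : ℤ) < A := by rw [hA]; exact_mod_cast hj'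
  have h1 : A * (l - l') < A * 2 := by
    rcases dirF_eq l with hd | hd <;> rcases dirF_eq l' with hd' | hd' <;>
      rw [hd, hd'] at h <;> linarith
  have h2 : A * (-2) < A * (l - l') := by
    rcases dirF_eq l with hd | hd <;> rcases dirF_eq l' with hd' | hd' <;>
      rw [hd, hd'] at h <;> linarith
  have hA0 : 0 < A := by positivity
  have h3 := lt_of_mul_lt_mul_left h1 hA0.le
  have h4 := lt_of_mul_lt_mul_left h2 hA0.le
  obtain ⟨a, rfl⟩ := hl
  obtain ⟨b, rfl⟩ := hl'
  omega

end Arithmetic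

section Forest

/-- A horizontal edge of a main part, oriented to the right. -/
def RightStep (v w : V) : Prop :=
  ∃ (k : ℕ) (l x : ℤ) (i : ℕ), 1 ≤ k ∧ Odd l ∧ IsTip k x ∧ i + 2 ≤ bF k ∧
    v = (x + i, rowY k l) ∧ w = (x + i + 1, rowY k l)

/-- A vertical edge of an abutment, oriented from the corner to the root. -/
def AbutStep (v w : V) : Prop :=
  ∃ (k : ℕ) (l x : ℤ) (j : ℕ), 1 ≤ k ∧ Odd l ∧ IsTip k x ∧ j < 3 * 2 ^ (k - 1) ∧
    v = (x + bF k - 1, rowY k l + dirF l * j) ∧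
    w = (x + bF k - 1, rowY k l + dirF l * (j + 1))

/-- The edges of `ξ`, oriented towards infinity. -/
def FwdStep (v w : V) : Prop := RightStep v w ∨ AbutStep v w

lemma mem_xiEdges_iff {v w : V} : s(v, w) ∈ xiEdges ↔ FwdStep v w ∨ FwdStep w v := by
  constructor
  · rintro ⟨k, l, x, hk, hl, hx, ⟨i, hi, h⟩ | ⟨j, hj, h⟩⟩
    · rcases Sym2.eq_iff.1 h with ⟨rfl, rfl⟩ | ⟨rfl, rfl⟩
      · exact .inl (.inl ⟨k, l, x, i, hk, hl, hx, hi, rfl, rfl⟩)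
      · exact .inr (.inl ⟨k, l, x, i, hk, hl, hx, hi, rfl, rfl⟩)
    · rcases Sym2.eq_iff.1 h with ⟨rfl, rfl⟩ | ⟨rfl, rfl⟩
      · exact .inl (.inr ⟨k, l, x, j, hk, hl, hx, hj, rfl, rfl⟩)
      · exact .inr (.inr ⟨k, l, x, j, hk, hl, hx, hj, rfl, rfl⟩)
  · rintro ((⟨k, l, x, i, hk, hl, hx, hi, rfl, rfl⟩ | ⟨k, l, x, j, hk, hl, hx, hj, rfl, rfl⟩) |
      (⟨k, l, x, i, hk, hl, hx, hi, rfl, rfl⟩ | ⟨k, l, x, j, hk, hl, hx, hj, rfl, rfl⟩))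
    · exact ⟨k, l, x, hk, hl, hx, .inl ⟨i, hi, rfl⟩⟩
    · exact ⟨k, l, x, hk, hl, hx, .inr ⟨j, hj, rfl⟩⟩
    · exact ⟨k, l, x, hk, hl, hx, .inl ⟨i, hi, Sym2.eq_swap⟩⟩
    · exact ⟨k, l, x, hk, hl, hx, .inr ⟨j, hj, Sym2.eq_swap⟩⟩

lemma RightStep.eq {v w : V} (h : RightStep v w) : w = (v.1 + 1, v.2) := by
  obtain ⟨k, l, x, i, -, -, -, -, rfl, rfl⟩ := h
  rfl

lemma AbutStep.eq {v w : V} (h : AbutStep v w) : w = (v.1, v.2 + 1) ∨ w = (v.1, v.2 - 1) := by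
  obtain ⟨k, l, x, j, -, -, -, -, rfl, rfl⟩ := h
  rcases dirF_eq l with hd | hd <;> rw [hd]
  · left; ext <;> simp; ring
  · right; ext <;> simp; ring

lemma RightStep.not_abutStep {v w w' : V} (h : RightStep v w) : ¬ AbutStep v w' := by
  rintro ⟨k', l', x', j, hk', hl', hx', hj, hv', -⟩
  obtain ⟨k, l, x, i, hk, hl, hx, hi, hv, -⟩ := h
  rw [hv, Prod.mk.injEq] at hv'
  obtain ⟨h1, h2⟩ := hv'
  have hle := order_le_of_rowY hk' hl' hj h2.symm
  have hdvd : (bF k : ℤ) ∣ x' + bF k' :=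
    dvd_trans (by exact_mod_cast bF_dvd hle) (dvd_add hx'.bF_dvd dvd_rfl)
  have h3 : x' + bF k' = x + ((i + 1 : ℕ) : ℤ) := by push_cast; linarith
  rw [h3, dvd_add_right hx.bF_dvd] at hdvd
  have := Nat.le_of_dvd (Nat.succ_pos i) (by exact_mod_cast hdvd)
  omega

lemma AbutStep.unique {v w w' : V} (h : AbutStep v w) (h' : AbutStep v w') : w = w' := by
  obtain ⟨k, l, x, j, hk, hl, hx, hj, hv, rfl⟩ := h
  obtain ⟨k', l', x', j', hk', hl', hx', hj', hv', rfl⟩ := h'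
  rw [hv, Prod.mk.injEq] at hv'
  obtain ⟨h1, h2⟩ := hv'
  have h1' : x + bF k = x' + bF k' := by linarith
  rcases lt_trichotomy k k' with hlt | rfl | hlt
  · exact absurd (h1' ▸ dvd_add hx'.bF_dvd dvd_rfl) (hx.not_dvd hk hlt)
  · obtain rfl := rowY_abutment_inj hl hl' hj hj' h2
    ext
    · exact h1
    · simp only
      linear_combination h2
  · exact absurd (h1' ▸ dvd_add hx.bF_dvd dvd_rfl) (hx'.not_dvd hk' hlt)

lemma FwdStep.unique {v w w' : V} (h : FwdStep v w) (h' : FwdStep v w') : w = w' := by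
  rcases h with h | h <;> rcases h' with h' | h'
  · rw [h.eq, h'.eq]
  · exact absurd h' h.not_abutStep
  · exact absurd h h'.not_abutStep
  · exact h.unique h'

open scoped Classical in
/-- The next vertex on the way to infinity. -/
def nextV (v : V) : V := if h : ∃ w, FwdStep v w then h.choose else v

lemma FwdStep.nextV_eq {v w : V} (h : FwdStep v w) : nextV v = w := by
  have h' : ∃ w, FwdStep v w := ⟨w, h⟩
  rw [nextV, dif_pos h']
  exact h'.choose_spec.unique h

lemma nextV_of_mem {v w : V} (h : s(v, w) ∈ xiEdges) : nextV v = w ∨ nextV w = v :=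
  (mem_xiEdges_iff.1 h).imp FwdStep.nextV_eq FwdStep.nextV_eq

/-- `v` is joined to its right neighbour in `ξ`. -/
def HasRight (v : V) : Prop := s(v, ((v.1 + 1, v.2) : V)) ∈ xiEdges

lemma HasRight.rightStep {v : V} (h : HasRight v) : RightStep v (v.1 + 1, v.2) := by
  rcases mem_xiEdges_iff.1 h with (h | h) | (h | h)
  · exact h
  · rcases h.eq with h | h <;> simp [Prod.ext_iff] at h
  · have := h.eq
    simp [Prod.ext_iff] at this
    omega
  · rcases h.eq with h | h <;> simp [Prod.ext_iff] at h

lemma RightStep.hasRight {v w : V} (h : RightStep v w) : HasRight v := by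
  have := mem_xiEdges_iff.2 (.inl (.inl h))
  rwa [h.eq] at this

lemma HasRight.nextV_eq {v : V} (h : HasRight v) : nextV v = (v.1 + 1, v.2) :=
  FwdStep.nextV_eq (.inl h.rightStep)

lemma AbutStep.not_hasRight {v w : V} (h : AbutStep v w) : ¬ HasRight v :=
  fun h' => h'.rightStep.not_abutStep h

lemma nextV_fst_of_not_hasRight {v : V} (h : ¬ HasRight v) : (nextV v).1 = v.1 := by
  by_cases he : ∃ w, FwdStep v w
  · obtain ⟨w, hw⟩ := he
    rw [hw.nextV_eq]
    rcases hw with hw | hw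
    · exact absurd hw.hasRight h
    · rcases hw.eq with rfl | rfl <;> rfl
  · rw [nextV, dif_neg he]

/-- The set of neighbours of a vertex in `ξ`. -/
def nbrs (v : V) : Set V := {u : V | s(v, u) ∈ xiEdges}

lemma nbrs_subset (v : V) :
    nbrs v ⊆ (({(v.1 + 1, v.2), (v.1 - 1, v.2), (v.1, v.2 + 1), (v.1, v.2 - 1)} : Finset V) :
      Set V) := by
  intro w hw
  have h1 : FwdStep v w ∨ FwdStep w v := mem_xiEdges_iff.1 hw
  obtain ⟨a, b⟩ := v
  obtain ⟨c, d⟩ := w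
  simp only [Finset.coe_insert, Finset.coe_singleton, Set.mem_insert_iff, Set.mem_singleton_iff,
    Prod.mk.injEq]
  rcases h1 with (h | h) | (h | h)
  · have := h.eq
    simp only [Prod.mk.injEq] at this
    omega
  · have := h.eq
    simp only [Prod.mk.injEq] at this
    omega
  · have := h.eq
    simp only [Prod.mk.injEq] at this
    omega
  · have := h.eq
    simp only [Prod.mk.injEq] at this
    omega

lemma nbrs_finite (v : V) : (nbrs v).Finite := (Finset.finite_toSet _).subset (nbrs_subset v)

lemma ncard_nbrs_le (v : V) : (nbrs v).ncard ≤ 4 := by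
  refine (Set.ncard_le_ncard (nbrs_subset v) (Finset.finite_toSet _)).trans ?_
  rw [Set.ncard_coe_finset]
  exact Finset.card_le_four

end Forest

section Resistance

/-- A bound for the total resistance of the abutments still to come on entering a branch of
order `m ≥ 2` from an attached branch, relative to the horizontal resistance `u ^ X` of the
column of entry, where `u = β⁻¹`. -/
def abutBound (u : ℝ) (m : ℕ) : ℝ :=
  if m ≤ 2 then 6 * u ^ 3 + u ^ 4 * (12 * u ^ 11 + u ^ 12 * (u ^ 2 / (1 - u)))
  else if m = 3 then 12 * u ^ 11 + u ^ 12 * (u ^ 2 / (1 - u))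
  else u ^ 2 / (1 - u)

lemma mul_pow_le_geom {u : ℝ} (h0 : 0 < u) (h1 : u < 1) (n : ℕ) :
    ((n + 1 : ℕ) : ℝ) * u ^ n ≤ (1 - u ^ (n + 1)) / (1 - u) := by
  have h : ∑ i ∈ Finset.range (n + 1), u ^ i = (1 - u ^ (n + 1)) / (1 - u) := by
    rw [geom_sum_eq h1.ne, ← neg_div_neg_eq, neg_sub, neg_sub]
  have hc := Finset.card_nsmul_le_sum (Finset.range (n + 1)) (fun i => u ^ i) (u ^ n) fun i hi =>
    pow_le_pow_of_le_one h0.le h1.le (Nat.lt_succ_iff.1 (Finset.mem_range.1 hi))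
  rwa [Finset.card_range, nsmul_eq_mul, h] at hc

lemma abutBound_nonneg {u : ℝ} (h0 : 0 < u) (h1 : u < 1) (m : ℕ) : 0 ≤ abutBound u m := by
  have : 0 < 1 - u := sub_pos.2 h1
  unfold abutBound
  split_ifs <;> positivity

lemma pow_add_le_of_le {u w a : ℝ} (h0 : 0 < u) (h1 : u < 1) (ha : 0 ≤ a) (hw : 0 ≤ w) {e n : ℕ}
    (he : n + 1 ≤ e) : a * u ^ (e - 1) + u ^ e * w ≤ a * u ^ n + u ^ (n + 1) * w := by
  have h2 := pow_le_pow_of_le_one h0.le h1.le (show n ≤ e - 1 by omega)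
  have h3 := pow_le_pow_of_le_one h0.le h1.le he
  gcongr

lemma abutBound_step {u : ℝ} (h0 : 0 < u) (h1 : u < 1) {m e : ℕ} (hm : 1 ≤ m) (he : bF m ≤ e) :
    3 * 2 ^ m * u ^ (e - 1) + u ^ e * abutBound u (m + 2) ≤ abutBound u (m + 1) := by
  have hu : 0 < 1 - u := sub_pos.2 h1
  have hw := abutBound_nonneg h0 h1 (m + 2)
  rcases (by omega : m = 1 ∨ m = 2 ∨ 3 ≤ m) with rfl | rfl | hm3
  · have he' : 3 + 1 ≤ e := he
    refine (pow_add_le_of_le h0 h1 (by positivity) hw he').trans ?_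
    norm_num [abutBound]
  · have he' : 11 + 1 ≤ e := by simpa [bF] using he
    refine (pow_add_le_of_le h0 h1 (by positivity) hw he').trans ?_
    norm_num [abutBound]
  · have hb := (three_mul_two_pow_le_bF hm3).trans he
    have e1 : abutBound u (m + 2) = u ^ 2 / (1 - u) := by
      unfold abutBound
      rw [if_neg (by omega), if_neg (by omega)]
    have e2 : abutBound u (m + 1) = u ^ 2 / (1 - u) := by
      unfold abutBound
      rw [if_neg (by omega), if_neg (by omega)]
    rw [e1, e2]
    obtain ⟨n, rfl⟩ : ∃ n, e = n + 3 := ⟨e - 3, by have := Nat.one_le_two_pow (n := m); omega⟩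
    have hg := mul_pow_le_geom h0 h1 n
    have hc : (3 * 2 ^ m : ℝ) ≤ ((n + 1 : ℕ) : ℝ) := by
      have : 3 * 2 ^ m ≤ n + 1 := by omega
      exact_mod_cast this
    have hg2 : (3 * 2 ^ m : ℝ) * u ^ n ≤ (1 - u ^ (n + 1)) / (1 - u) :=
      (mul_le_mul_of_nonneg_right hc (by positivity)).trans hg
    have hp : u ^ (n + 3) ≤ u ^ (n + 1) := pow_le_pow_of_le_one h0.le h1.le (by omega)
    calc 3 * 2 ^ m * u ^ (n + 3 - 1) + u ^ (n + 3) * (u ^ 2 / (1 - u))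
        ≤ u ^ 2 * (3 * 2 ^ m * u ^ n) + u ^ (n + 1) * (u ^ 2 / (1 - u)) := by
          have : u ^ (n + 3 - 1) = u ^ 2 * u ^ n := by
            rw [← pow_add]
            congr 1
            omega
          rw [this]
          have : 0 ≤ u ^ 2 / (1 - u) := by positivity
          gcongr ?_ + ?_
          · exact le_of_eq (by ring)
          · exact mul_le_mul_of_nonneg_right hp this
      _ ≤ u ^ 2 * ((1 - u ^ (n + 1)) / (1 - u)) + u ^ (n + 1) * (u ^ 2 / (1 - u)) := by gcongr
      _ = u ^ 2 / (1 - u) := by field_simp; ring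

lemma abutBound_start {u : ℝ} (h0 : 0 < u) (h1 : u < 1) {k e : ℕ} (hk : 1 ≤ k)
    (he : 3 * 2 ^ (k - 1) ≤ e) :
    3 * 2 ^ (k - 1) * u ^ (e - 1) + u ^ e * abutBound u (k + 1) ≤ 1 / (1 - u) := by
  have hu : 0 < 1 - u := sub_pos.2 h1
  have hw := abutBound_nonneg h0 h1 (k + 1)
  rcases (by omega : k = 1 ∨ 2 ≤ k) with rfl | hk2
  · refine (pow_add_le_of_le h0 h1 (by positivity) hw (n := 2) (by simpa using he)).trans ?_
    simp only [abutBound, le_refl, if_true, Nat.reduceAdd]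
    have key : 0 ≤ 1 - (3 * u ^ 2 + 6 * u ^ 6 + 12 * u ^ 18) * (1 - u) - u ^ 21 := by
      have h9 : ∀ i j : ℕ, i ≤ j → u ^ j ≤ u ^ i := fun i j h =>
        pow_le_pow_of_le_one h0.le h1.le h
      have hid : 1 - (3 * u ^ 2 + 6 * u ^ 6 + 12 * u ^ 18) * (1 - u) - u ^ 21 =
          (1 - u) ^ 2 * (1 + 2 * u + u ^ 3 + 2 * u ^ 4 + 3 * u ^ 5 - 2 * u ^ 6 - u ^ 7 +
            (u ^ 9 + 2 * u ^ 10 + 3 * u ^ 11 + 4 * u ^ 12 + 5 * u ^ 13 + 6 * u ^ 14 + 7 * u ^ 15 +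
              8 * u ^ 16 + 9 * u ^ 17 - 2 * u ^ 18 - u ^ 19)) := by ring
      rw [hid]
      have a1 := h9 5 6 (by norm_num)
      have a2 := h9 5 7 (by norm_num)
      have a3 := h9 17 18 (by norm_num)
      have a4 := h9 17 19 (by norm_num)
      have p : ∀ i : ℕ, 0 ≤ u ^ i := fun i => by positivity
      refine mul_nonneg (sq_nonneg _) ?_
      linarith [p 3, p 4, p 5, p 9, p 10, p 11, p 12, p 13, p 14, p 15, p 16, p 17]
    rw [le_div_iff₀ hu]
    have : (3 * 2 ^ (1 - 1) * u ^ 2 +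
        u ^ 3 * (6 * u ^ 3 + u ^ 4 * (12 * u ^ 11 + u ^ 12 * (u ^ 2 / (1 - u))))) * (1 - u) =
        (3 * u ^ 2 + 6 * u ^ 6 + 12 * u ^ 18) * (1 - u) + u ^ 21 := by
      field_simp
      ring
    linarith
  · have hle : abutBound u (k + 1) ≤ 1 / (1 - u) := by
      unfold abutBound
      rw [if_neg (by omega)]
      split_ifs
      · have hg := mul_pow_le_geom h0 h1 11
        norm_num at hg
        have hp : u ^ 14 ≤ u ^ 12 := pow_le_pow_of_le_one h0.le h1.le (by norm_num)
        have : u ^ 12 * (u ^ 2 / (1 - u)) ≤ u ^ 12 / (1 - u) := by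
          rw [mul_div_assoc', ← pow_add]
          gcongr
        calc _ ≤ (1 - u ^ 12) / (1 - u) + u ^ 12 / (1 - u) := add_le_add hg this
          _ = 1 / (1 - u) := by rw [← add_div]; ring
      · gcongr
        exact pow_le_one₀ h0.le h1.le
    obtain ⟨n, rfl⟩ : ∃ n, e = n + 1 :=
      ⟨e - 1, by have := Nat.one_le_two_pow (n := k - 1); omega⟩
    have hc : (3 * 2 ^ (k - 1) : ℝ) ≤ ((n + 1 : ℕ) : ℝ) := by exact_mod_cast he
    calc 3 * 2 ^ (k - 1) * u ^ (n + 1 - 1) + u ^ (n + 1) * abutBound u (k + 1)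
        ≤ ((n + 1 : ℕ) : ℝ) * u ^ n + u ^ (n + 1) * (1 / (1 - u)) := by
          rw [Nat.add_sub_cancel]
          gcongr
      _ ≤ (1 - u ^ (n + 1)) / (1 - u) + u ^ (n + 1) * (1 / (1 - u)) := by
          gcongr
          exact mul_pow_le_geom h0 h1 n
      _ = 1 / (1 - u) := by field_simp; ring

open scoped Classical in
/-- The resistance of the edge from `v` to `nextV v`, where `u = β⁻¹`. -/
def resist (u : ℝ) (v : V) : ℝ := if HasRight v then u ^ v.1 else u ^ (v.1 - 1)

lemma resist_pos {u : ℝ} (h0 : 0 < u) (v : V) : 0 < resist u v := by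
  unfold resist
  split_ifs <;> positivity

/-- The resistance of the edge behind a vertex, in terms of the column of that vertex. -/
lemma resist_eq_of_nextV {u : ℝ} (v : V) : resist u v = u ^ ((nextV v).1 - 1) := by
  unfold resist
  split_ifs with h
  · rw [h.nextV_eq]
    simp
  · rw [nextV_fst_of_not_hasRight h]

/-- `v` lies on a main part, left of the corner, and `Φ` bounds the resistance from `v` to
infinity. -/
def MainState (u : ℝ) (v : V) (Φ : ℝ) : Prop :=
  ∃ (k : ℕ) (l x : ℤ) (i e : ℕ), 1 ≤ k ∧ Odd l ∧ IsTip k x ∧ i + e + 2 = bF k ∧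
    v = (x + i, rowY k l) ∧
    Φ = u ^ v.1 * (1 / (1 - u) + (3 * 2 ^ (k - 1) * u ^ e + u ^ (e + 1) * abutBound u (k + 1)))

/-- `v` lies on an abutment, before the root, and `Φ` bounds the resistance from `v` to
infinity. -/
def AbutState (u : ℝ) (v : V) (Φ : ℝ) : Prop :=
  ∃ (k : ℕ) (l x : ℤ) (j r : ℕ), 1 ≤ k ∧ Odd l ∧ IsTip k x ∧ j + r + 1 = 3 * 2 ^ (k - 1) ∧
    v = (x + bF k - 1, rowY k l + dirF l * j) ∧
    Φ = u ^ v.1 * (1 / (1 - u) + abutBound u (k + 1)) + (r + 1) * u ^ (v.1 - 1)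

lemma MainState.nonneg {u : ℝ} (h0 : 0 < u) (h1 : u < 1) {v : V} {Φ : ℝ}
    (h : MainState u v Φ) : 0 ≤ Φ := by
  obtain ⟨k, l, x, i, e, -, -, -, -, -, rfl⟩ := h
  have hu : 0 < 1 - u := sub_pos.2 h1
  have := abutBound_nonneg h0 h1 (k + 1)
  positivity

lemma AbutState.nonneg {u : ℝ} (h0 : 0 < u) (h1 : u < 1) {v : V} {Φ : ℝ}
    (h : AbutState u v Φ) : 0 ≤ Φ := by
  obtain ⟨k, l, x, j, r, -, -, -, -, -, rfl⟩ := h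
  have hu : 0 < 1 - u := sub_pos.2 h1
  have := abutBound_nonneg h0 h1 (k + 1)
  positivity

lemma MainState.fwdStep {u : ℝ} {v : V} {Φ : ℝ} (h : MainState u v Φ) : FwdStep v (nextV v) := by
  obtain ⟨k, l, x, i, e, hk, hl, hx, hi, hv, -⟩ := h
  have hs : FwdStep v (x + i + 1, rowY k l) :=
    .inl ⟨k, l, x, i, hk, hl, hx, by omega, hv, rfl⟩
  rwa [hs.nextV_eq]

lemma AbutState.fwdStep {u : ℝ} {v : V} {Φ : ℝ} (h : AbutState u v Φ) : FwdStep v (nextV v) := by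
  obtain ⟨k, l, x, j, r, hk, hl, hx, hj, hv, -⟩ := h
  have hs : FwdStep v (x + bF k - 1, rowY k l + dirF l * (j + 1)) :=
    .inr ⟨k, l, x, j, hk, hl, hx, by omega, hv, rfl⟩
  rwa [hs.nextV_eq]

lemma one_div_one_sub {u : ℝ} (h1 : u < 1) : 1 / (1 - u) = 1 + u * (1 / (1 - u)) := by
  have hu : 1 - u ≠ 0 := (sub_pos.2 h1).ne'
  field_simp
  ring

lemma MainState.next {u : ℝ} (h0 : 0 < u) (h1 : u < 1) {v : V} {Φ : ℝ} (h : MainState u v Φ) :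
    ∃ Φ', (MainState u (nextV v) Φ' ∨ AbutState u (nextV v) Φ') ∧ resist u v + Φ' ≤ Φ := by
  obtain ⟨k, l, x, i, e, hk, hl, hx, hi, hv, rfl⟩ := h
  have hs : RightStep v (x + i + 1, rowY k l) := ⟨k, l, x, i, hk, hl, hx, by omega, hv, rfl⟩
  have hg := one_div_one_sub h1
  have hres : resist u v = u ^ v.1 := if_pos hs.hasRight
  have hu1 : u ^ ((x + i + 1 : ℤ)) = u ^ v.1 * u := by rw [hv]; exact zpow_add_one₀ h0.ne' _
  rw [FwdStep.nextV_eq (.inl hs), hres]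
  rcases e with _ | e
  · refine ⟨_, .inr ⟨k, l, x, 0, 3 * 2 ^ (k - 1) - 1, hk, hl, hx, ?_, ?_, rfl⟩, ?_⟩
    · have := Nat.one_le_two_pow (n := k - 1)
      omega
    · rw [← hi]
      ext <;> push_cast <;> ring
    · have hc : ((3 * 2 ^ (k - 1) - 1 : ℕ) : ℝ) + 1 = 3 * 2 ^ (k - 1) := by
        have : 3 * 2 ^ (k - 1) - 1 + 1 = 3 * 2 ^ (k - 1) := by
          have := Nat.one_le_two_pow (n := k - 1)
          omega
        exact_mod_cast this
      have hx1 : u ^ (x + (i : ℤ) + 1 - 1) = u ^ v.1 := by rw [hv, add_sub_cancel_right]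
      simp only [hc, hu1, hx1]
      refine le_of_eq ?_
      linear_combination (-(u ^ v.1)) * hg
  · refine ⟨_, .inl ⟨k, l, x, i + 1, e, hk, hl, hx, by omega, ?_, rfl⟩, ?_⟩
    · push_cast
      rw [add_assoc]
    · simp only [hu1]
      refine le_of_eq ?_
      linear_combination (-(u ^ v.1)) * hg

lemma AbutState.next {u : ℝ} (h0 : 0 < u) (h1 : u < 1) {v : V} {Φ : ℝ} (h : AbutState u v Φ) :
    ∃ Φ', (MainState u (nextV v) Φ' ∨ AbutState u (nextV v) Φ') ∧ resist u v + Φ' ≤ Φ := by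
  obtain ⟨k, l, x, j, r, hk, hl, hx, hj, hv, rfl⟩ := h
  have hs : AbutStep v (x + bF k - 1, rowY k l + dirF l * (j + 1)) :=
    ⟨k, l, x, j, hk, hl, hx, by omega, hv, rfl⟩
  have hres : resist u v = u ^ (v.1 - 1) := if_neg hs.not_hasRight
  have hv1 : v.1 = x + bF k - 1 := by rw [hv]
  rw [FwdStep.nextV_eq (.inr hs), hres]
  rcases r with _ | r
  · obtain ⟨l', hl', hll⟩ := exists_odd_of_dirF hl
    obtain ⟨x', j', hx', hj1, hj2, hxx⟩ := hx.exists_parent hk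
    have hle := mul_bF_add_le hj2
    have hb := four_le_bF k
    have hjb : 1 * bF k ≤ j' * bF k := Nat.mul_le_mul_right _ hj1
    refine ⟨_, .inl ⟨k + 1, l', x', j' * bF k - 1, bF (k + 1) - (j' * bF k) - 1, by omega, hl',
      hx', by omega, ?_, rfl⟩, ?_⟩
    · have hroot := rowY_root hk hll
      rw [← hj] at hroot
      ext
      · push_cast [Nat.cast_sub (show 1 ≤ j' * bF k by omega)]
        linarith
      · rw [← hroot]
        push_cast
        ring
    · have hst := abutBound_step h0 h1 hk
        (show bF k ≤ bF (k + 1) - (j' * bF k) by omega)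
      have he : bF (k + 1) - j' * bF k - 1 + 1 = bF (k + 1) - j' * bF k := by omega
      simp only [← hv1, he, Nat.add_sub_cancel]
      have hpos : 0 < u ^ v.1 := zpow_pos h0 _
      have := mul_le_mul_of_nonneg_left hst hpos.le
      push_cast
      linarith
  · refine ⟨_, .inr ⟨k, l, x, j + 1, r, hk, hl, hx, by omega, ?_, rfl⟩, ?_⟩
    · push_cast
      rfl
    · simp only [← hv1]
      push_cast
      exact le_of_eq (by ring)

/-- The total resistance of the ray from `v` to infinity. -/
def rayResist (u : ℝ) (v : V) : ℝ := ∑' n : ℕ, resist u (nextV^[n] v)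

lemma exists_state_iterate {u : ℝ} (h0 : 0 < u) (h1 : u < 1) {v : V} {Φ : ℝ}
    (h : MainState u v Φ) (n : ℕ) :
    ∃ Φ', (MainState u (nextV^[n] v) Φ' ∨ AbutState u (nextV^[n] v) Φ') ∧
      ∑ i ∈ Finset.range n, resist u (nextV^[i] v) + Φ' ≤ Φ := by
  induction n with
  | zero => exact ⟨Φ, .inl h, by simp⟩
  | succ n ih =>
    obtain ⟨Φ₁, hs, hle⟩ := ih
    obtain ⟨Φ₂, hs', hle'⟩ : ∃ Φ', (MainState u (nextV (nextV^[n] v)) Φ' ∨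
        AbutState u (nextV (nextV^[n] v)) Φ') ∧ resist u (nextV^[n] v) + Φ' ≤ Φ₁ :=
      hs.elim (·.next h0 h1) (·.next h0 h1)
    rw [← Function.iterate_succ_apply' nextV n v] at hs'
    refine ⟨Φ₂, hs', ?_⟩
    rw [Finset.sum_range_succ]
    linarith

lemma MainState.sum_le {u : ℝ} (h0 : 0 < u) (h1 : u < 1) {v : V} {Φ : ℝ}
    (h : MainState u v Φ) (n : ℕ) : ∑ i ∈ Finset.range n, resist u (nextV^[i] v) ≤ Φ := by
  obtain ⟨Φ', hs, hle⟩ := exists_state_iterate h0 h1 h n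
  have := hs.elim (·.nonneg h0 h1) (·.nonneg h0 h1)
  linarith

/-- From a vertex as in the main theorem there is a ray of edges to infinity, whose total
resistance is controlled by that of the first edge. -/
lemma ray_of_onMainPart {u : ℝ} (h0 : 0 < u) (h1 : u < 1) {k : ℕ} (hk : 1 ≤ k) {l x : ℤ}
    (hl : Odd l) (hx : IsTip k x) {z : V} (hz : OnMainPart k l x z)
    (hleft : z.1 ≤ x + bF k - 1 - 3 * 2 ^ (k - 1)) :
    HasRight z ∧ (∀ n, FwdStep (nextV^[n] z) (nextV^[n + 1] z)) ∧
      Summable (fun n => resist u (nextV^[n] z)) ∧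
      rayResist u z ≤ 2 / (1 - u) * resist u z := by
  obtain ⟨hz2, hz1, -⟩ := hz
  obtain ⟨i, hi⟩ := Int.eq_ofNat_of_zero_le (sub_nonneg.2 hz1)
  have hpow := Nat.one_le_two_pow (n := k - 1)
  have hle : i + 1 + 3 * 2 ^ (k - 1) ≤ bF k := by
    zify
    linarith
  have hv : z = (x + i, rowY k l) := by
    ext
    · simp only
      linarith
    · exact hz2
  obtain ⟨e, he⟩ : ∃ e, i + e + 2 = bF k := ⟨bF k - i - 2, by omega⟩
  have hst : MainState u z _ := ⟨k, l, x, i, e, hk, hl, hx, he, hv, rfl⟩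
  have hr : HasRight z := RightStep.hasRight ⟨k, l, x, i, hk, hl, hx, by omega, hv, rfl⟩
  have hsum := hst.sum_le h0 h1
  have hnn : ∀ n, 0 ≤ resist u (nextV^[n] z) := fun n => (resist_pos h0 _).le
  refine ⟨hr, fun n => ?_, summable_of_sum_range_le hnn hsum, ?_⟩
  · obtain ⟨Φ', hs, -⟩ := exists_state_iterate h0 h1 hst n
    rw [Function.iterate_succ_apply']
    exact hs.elim (·.fwdStep) (·.fwdStep)
  · refine (Real.tsum_le_of_sum_range_le hnn hsum).trans ?_
    have hb := abutBound_start h0 h1 hk (show 3 * 2 ^ (k - 1) ≤ e + 1 by omega)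
    rw [Nat.add_sub_cancel] at hb
    have hres : resist u z = u ^ z.1 := if_pos hr
    rw [hres, mul_comm (2 / (1 - u))]
    have hpos : 0 < u ^ z.1 := zpow_pos h0 _
    refine mul_le_mul_of_nonneg_left ?_ hpos.le
    calc _ ≤ 1 / (1 - u) + 1 / (1 - u) := by gcongr
      _ = 2 / (1 - u) := by ring

end Resistance

section Superharmonic

lemma transProb_nonneg {β : ℝ} (hβ : 1 < β) (G : Set (Sym2 V)) (v w : V) :
    0 ≤ transProb β G v w := by
  have h : ∀ n : ℕ, 0 ≤ β + (n : ℝ) - 1 := fun n => by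
    have := n.cast_nonneg (α := ℝ)
    linarith
  unfold transProb
  split_ifs
  · exact zero_le_one
  · exact le_rfl
  · exact div_nonneg (by linarith) (h _)
  · exact div_nonneg zero_le_one (h _)
  · positivity
  · exact le_rfl

lemma transProb_of_not_mem {β : ℝ} {v w : V} (hne : (nbrs v).Nonempty) (hw : w ∉ nbrs v) :
    transProb β xiEdges v w = 0 := by
  have h1 : {u : V | s(v, u) ∈ xiEdges} ≠ ∅ := hne.ne_empty
  have h2 : ¬ s(v, w) ∈ xiEdges := hw
  rw [transProb, if_neg h1, if_neg h2]

lemma transProb_right {β : ℝ} {v : V} (hr : HasRight v) :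
    transProb β xiEdges v (v.1 + 1, v.2) = β / (β + (nbrs v).ncard - 1) := by
  have h2 : s(v, ((v.1 + 1, v.2) : V)) ∈ xiEdges := hr
  have h1 : {u : V | s(v, u) ∈ xiEdges} ≠ ∅ := Set.Nonempty.ne_empty ⟨_, h2⟩
  rw [transProb, if_neg h1, if_pos h2, if_pos h2, if_pos rfl, nbrs]

lemma transProb_other {β : ℝ} {v w : V} (hr : HasRight v) (hw : w ∈ nbrs v)
    (hne : w ≠ (v.1 + 1, v.2)) :
    transProb β xiEdges v w = 1 / (β + (nbrs v).ncard - 1) := by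
  have h2 : s(v, ((v.1 + 1, v.2) : V)) ∈ xiEdges := hr
  have h3 : s(v, w) ∈ xiEdges := hw
  have h1 : {u : V | s(v, u) ∈ xiEdges} ≠ ∅ := Set.Nonempty.ne_empty ⟨_, h2⟩
  rw [transProb, if_neg h1, if_pos h3, if_pos h2, if_neg hne, nbrs]

lemma transProb_uniform {β : ℝ} {v w : V} (hr : ¬ HasRight v) (hw : w ∈ nbrs v) :
    transProb β xiEdges v w = 1 / ((nbrs v).ncard : ℝ) := by
  have h2 : ¬ s(v, ((v.1 + 1, v.2) : V)) ∈ xiEdges := hr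
  have h3 : s(v, w) ∈ xiEdges := hw
  have h1 : {u : V | s(v, u) ∈ xiEdges} ≠ ∅ := Set.Nonempty.ne_empty ⟨_, h3⟩
  rw [transProb, if_neg h1, if_pos h3, if_neg h2, nbrs]

/-- The neighbours of a vertex as a finite set. -/
def nbrsFinset (v : V) : Finset V := (nbrs_finite v).toFinset

lemma mem_nbrsFinset {v w : V} : w ∈ nbrsFinset v ↔ w ∈ nbrs v := Set.Finite.mem_toFinset _

lemma ncard_nbrs (v : V) : (nbrs v).ncard = (nbrsFinset v).card :=
  Set.ncard_eq_toFinset_card _ _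

lemma sum_transProb {β : ℝ} (hβ : 1 < β) {v : V} (hne : (nbrs v).Nonempty) :
    ∑ w ∈ nbrsFinset v, transProb β xiEdges v w = 1 := by
  by_cases hr : HasRight v
  · have hmem : ((v.1 + 1, v.2) : V) ∈ nbrsFinset v := mem_nbrsFinset.2 hr
    have hrest : ∀ w ∈ (nbrsFinset v).erase (v.1 + 1, v.2),
        transProb β xiEdges v w = 1 / (β + (nbrs v).ncard - 1) := fun w hw =>
      transProb_other hr (mem_nbrsFinset.1 (Finset.mem_of_mem_erase hw)) (Finset.ne_of_mem_erase hw)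
    have hc : 1 ≤ (nbrsFinset v).card := Finset.card_pos.2 ⟨_, hmem⟩
    have hc' : (1 : ℝ) ≤ ((nbrsFinset v).card : ℝ) := by exact_mod_cast hc
    rw [← Finset.add_sum_erase _ _ hmem, transProb_right hr, Finset.sum_congr rfl hrest,
      Finset.sum_const, Finset.card_erase_of_mem hmem, nsmul_eq_mul, Nat.cast_sub hc, ncard_nbrs]
    have : β + ((nbrsFinset v).card : ℝ) - 1 ≠ 0 := by linarith
    field_simp
    push_cast
    ring
  · have hc : 0 < (nbrsFinset v).card := by
      obtain ⟨w, hw⟩ := hne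
      exact Finset.card_pos.2 ⟨w, mem_nbrsFinset.2 hw⟩
    have hc' : ((nbrsFinset v).card : ℝ) ≠ 0 := by exact_mod_cast hc.ne'
    rw [Finset.sum_congr rfl fun w hw => transProb_uniform hr (mem_nbrsFinset.1 hw),
      Finset.sum_const, nsmul_eq_mul, ncard_nbrs]
    field_simp

lemma tsum_transProb_mul {β : ℝ} (hβ : 1 < β) {v : V} (hne : (nbrs v).Nonempty) {h : V → ℝ}
    (hh : ∀ w, 0 ≤ h w) :
    ∑' w, ENNReal.ofReal (transProb β xiEdges v w) * ENNReal.ofReal (h w) =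
      ENNReal.ofReal (∑ w ∈ nbrsFinset v, transProb β xiEdges v w * h w) := by
  rw [tsum_eq_sum (s := nbrsFinset v), ENNReal.ofReal_sum_of_nonneg]
  · exact Finset.sum_congr rfl fun w _ => (ENNReal.ofReal_mul (transProb_nonneg hβ _ _ _)).symm
  · exact fun w _ => mul_nonneg (transProb_nonneg hβ _ _ _) (hh w)
  · intro w hw
    rw [transProb_of_not_mem hne (fun h => hw (mem_nbrsFinset.2 h)), ENNReal.ofReal_zero, zero_mul]

lemma summable_iterate {u : ℝ} {z : V} (hs : Summable fun n => resist u (nextV^[n] z)) (n : ℕ) :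
    Summable fun m => resist u (nextV^[m] (nextV^[n] z)) := by
  simpa only [← Function.iterate_add_apply] using (summable_nat_add_iff n).2 hs

lemma rayResist_eq {u : ℝ} {v : V} (hs : Summable fun n => resist u (nextV^[n] v)) :
    rayResist u v = resist u v + rayResist u (nextV v) := by
  rw [rayResist, hs.tsum_eq_zero_add]
  rfl

lemma rayResist_iterate_eq {u : ℝ} {z : V} (hs : Summable fun n => resist u (nextV^[n] z))
    (n : ℕ) : rayResist u (nextV^[n] z) =
      resist u (nextV^[n] z) + rayResist u (nextV^[n + 1] z) := by
  rw [rayResist_eq (summable_iterate hs n), Function.iterate_succ_apply']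

lemma rayResist_strictAnti {u : ℝ} (h0 : 0 < u) {z : V}
    (hs : Summable fun n => resist u (nextV^[n] z)) :
    StrictAnti fun n => rayResist u (nextV^[n] z) := by
  refine strictAnti_nat_of_succ_lt fun n => ?_
  have := resist_pos h0 (nextV^[n] z)
  have := rayResist_iterate_eq hs n
  linarith

lemma iterate_injective {u : ℝ} (h0 : 0 < u) {z : V}
    (hs : Summable fun n => resist u (nextV^[n] z)) {m n : ℕ}
    (h : nextV^[m] z = nextV^[n] z) : m = n :=
  (rayResist_strictAnti h0 hs).injective (congrArg (rayResist u) h)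

lemma rayResist_nonneg {u : ℝ} (h0 : 0 < u) (v : V) : 0 ≤ rayResist u v :=
  tsum_nonneg fun _ => (resist_pos h0 _).le

lemma rayResist_pos {u : ℝ} (h0 : 0 < u) {z : V}
    (hs : Summable fun n => resist u (nextV^[n] z)) : 0 < rayResist u z := by
  rw [rayResist_eq hs]
  exact add_pos_of_pos_of_nonneg (resist_pos h0 _) (rayResist_nonneg h0 _)

/-- The index of the vertex at which the path from `v` to infinity meets the ray from `z`. -/
def mergeIndex (z v : V) : ℕ := sInf {n | ∃ m, nextV^[m] v = nextV^[n] z}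

/-- The voltage function of the ray from `z`, extended to be constant on the bushes hanging
off the ray. -/
def voltage (u : ℝ) (z v : V) : ℝ :=
  rayResist u (nextV^[mergeIndex z v] z) / rayResist u z

lemma mergeIndex_iterate {u : ℝ} (h0 : 0 < u) {z : V}
    (hs : Summable fun n => resist u (nextV^[n] z)) (n : ℕ) :
    mergeIndex z (nextV^[n] z) = n := by
  have : {j | ∃ m, nextV^[m] (nextV^[n] z) = nextV^[j] z} = Set.Ici n := by
    ext j
    simp only [← Function.iterate_add_apply, Set.mem_ofPred_eq, Set.mem_Ici]
    constructor
    · rintro ⟨m, hm⟩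
      have := iterate_injective h0 hs hm
      omega
    · intro h
      exact ⟨j - n, by rw [Nat.sub_add_cancel h]⟩
  rw [mergeIndex, this, csInf_Ici]

lemma mergeIndex_nextV {z v : V} (hv : ∀ n, v ≠ nextV^[n] z) :
    mergeIndex z (nextV v) = mergeIndex z v := by
  unfold mergeIndex
  congr 1
  ext n
  constructor
  · rintro ⟨m, hm⟩
    exact ⟨m + 1, hm⟩
  · rintro ⟨m, hm⟩
    cases m with
    | zero => exact absurd hm (hv n)
    | succ m => exact ⟨m, hm⟩

lemma voltage_nonneg {u : ℝ} (h0 : 0 < u) (z v : V) : 0 ≤ voltage u z v :=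
  div_nonneg (rayResist_nonneg h0 _) (rayResist_nonneg h0 _)

lemma voltage_le_one {u : ℝ} (h0 : 0 < u) {z : V}
    (hs : Summable fun n => resist u (nextV^[n] z)) (v : V) : voltage u z v ≤ 1 :=
  (div_le_one (rayResist_pos h0 hs)).2 ((rayResist_strictAnti h0 hs).antitone (Nat.zero_le _))

lemma voltage_iterate {u : ℝ} (h0 : 0 < u) {z : V}
    (hs : Summable fun n => resist u (nextV^[n] z)) (n : ℕ) :
    voltage u z (nextV^[n] z) = rayResist u (nextV^[n] z) / rayResist u z := by
  rw [voltage, mergeIndex_iterate h0 hs]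

lemma voltage_self {u : ℝ} (h0 : 0 < u) {z : V}
    (hs : Summable fun n => resist u (nextV^[n] z)) : voltage u z z = 1 :=
  (voltage_iterate h0 hs 0).trans (div_self (rayResist_pos h0 hs).ne')

lemma voltage_iterate_succ {u : ℝ} (h0 : 0 < u) {z : V}
    (hs : Summable fun n => resist u (nextV^[n] z)) (n : ℕ) :
    voltage u z (nextV^[n + 1] z) =
      voltage u z (nextV^[n] z) - resist u (nextV^[n] z) / rayResist u z := by
  rw [voltage_iterate h0 hs, voltage_iterate h0 hs, rayResist_iterate_eq hs n]
  ring

lemma voltage_of_not_mem_ray {u : ℝ} {z v w : V} (hv : ∀ n, v ≠ nextV^[n] z)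
    (hw : w ∈ nbrs v) : voltage u z w = voltage u z v := by
  rcases nextV_of_mem hw with rfl | rfl
  · rw [voltage, voltage, mergeIndex_nextV hv]
  · have hw' : ∀ n, w ≠ nextV^[n] z := by
      rintro n rfl
      exact hv (n + 1) (Function.iterate_succ_apply' _ _ _).symm
    rw [voltage, voltage, mergeIndex_nextV hw']

/-- Kirchhoff's law along the ray. -/
lemma transProb_mul_resist {β : ℝ} (hβ : 1 < β) {z : V}
    (hf : ∀ n, FwdStep (nextV^[n] z) (nextV^[n + 1] z))
    (hs : Summable fun n => resist β⁻¹ (nextV^[n] z)) (n : ℕ) :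
    transProb β xiEdges (nextV^[n + 1] z) (nextV^[n + 2] z) * resist β⁻¹ (nextV^[n + 1] z) =
      transProb β xiEdges (nextV^[n + 1] z) (nextV^[n] z) * resist β⁻¹ (nextV^[n] z) := by
  have hβ0 : 0 < β := by linarith
  have hr := resist_eq_of_nextV (u := β⁻¹) (nextV^[n] z)
  rw [← Function.iterate_succ_apply' nextV n z] at hr
  have hne : nextV^[n] z ≠ nextV^[n + 2] z := fun h => by
    have := iterate_injective (inv_pos.2 hβ0) hs h
    omega
  have ha : nextV^[n + 2] z ∈ nbrs (nextV^[n + 1] z) := mem_xiEdges_iff.2 (.inl (hf (n + 1)))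
  have hb : nextV^[n] z ∈ nbrs (nextV^[n + 1] z) := mem_xiEdges_iff.2 (.inr (hf n))
  have hnext : nextV^[n + 2] z = nextV (nextV^[n + 1] z) := Function.iterate_succ_apply' _ _ _
  rw [hr]
  generalize nextV^[n] z = b at *
  generalize nextV^[n + 2] z = a at *
  generalize nextV^[n + 1] z = v at *
  by_cases h : HasRight v
  · rw [h.nextV_eq] at hnext
    subst hnext
    rw [transProb_right h, transProb_other h hb hne, resist, if_pos h,
      zpow_sub_one₀ (inv_ne_zero hβ0.ne'), inv_inv]
    ring
  · rw [transProb_uniform h ha, transProb_uniform h hb, resist, if_neg h]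

lemma voltage_superharmonic {β : ℝ} (hβ : 1 < β) {z : V}
    (hf : ∀ n, FwdStep (nextV^[n] z) (nextV^[n + 1] z))
    (hs : Summable fun n => resist β⁻¹ (nextV^[n] z)) {v : V} (hv : v ≠ z) :
    ∑' w, ENNReal.ofReal (transProb β xiEdges v w) * ENNReal.ofReal (voltage β⁻¹ z w) ≤
      ENNReal.ofReal (voltage β⁻¹ z v) := by
  have h0 : 0 < β⁻¹ := by positivity
  rcases (nbrs v).eq_empty_or_nonempty with hem | hne
  · have h1 : {u : V | s(v, u) ∈ xiEdges} = ∅ := hem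
    rw [tsum_eq_single v]
    · rw [transProb, if_pos h1, if_pos rfl, ENNReal.ofReal_one, one_mul]
    · intro w hw
      rw [transProb, if_pos h1, if_neg hw, ENNReal.ofReal_zero, zero_mul]
  rw [tsum_transProb_mul hβ hne (voltage_nonneg h0 z)]
  refine ENNReal.ofReal_le_ofReal ?_
  have hsum := sum_transProb hβ hne
  by_cases hray : ∀ n, v ≠ nextV^[n] z
  · rw [Finset.sum_congr rfl fun w hw => by
      rw [voltage_of_not_mem_ray hray (mem_nbrsFinset.1 hw)], ← Finset.sum_mul, hsum, one_mul]
  push Not at hray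
  obtain ⟨n, rfl⟩ := hray
  obtain ⟨n, rfl⟩ : ∃ m, n = m + 1 := Nat.exists_eq_succ_of_ne_zero (by rintro rfl; exact hv rfl)
  have hne' : nextV^[n] z ≠ nextV^[n + 2] z := fun h => by
    have := iterate_injective h0 hs h
    omega
  have ha : nextV^[n + 2] z ∈ nbrsFinset (nextV^[n + 1] z) :=
    mem_nbrsFinset.2 (mem_xiEdges_iff.2 (.inl (hf (n + 1))))
  have hb : nextV^[n] z ∈ nbrsFinset (nextV^[n + 1] z) :=
    mem_nbrsFinset.2 (mem_xiEdges_iff.2 (.inr (hf n)))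
  have hva := voltage_iterate_succ h0 hs (n + 1)
  have hvb := voltage_iterate_succ h0 hs n
  have hk := transProb_mul_resist hβ hf hs n
  have hterm : ∀ w ∈ nbrsFinset (nextV^[n + 1] z),
      transProb β xiEdges (nextV^[n + 1] z) w * voltage β⁻¹ z w =
        transProb β xiEdges (nextV^[n + 1] z) w * voltage β⁻¹ z (nextV^[n + 1] z)
        - (if w = nextV^[n + 2] z then transProb β xiEdges (nextV^[n + 1] z) (nextV^[n + 2] z) *
            resist β⁻¹ (nextV^[n + 1] z) / rayResist β⁻¹ z else 0)
        + (if w = nextV^[n] z then transProb β xiEdges (nextV^[n + 1] z) (nextV^[n] z) *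
            resist β⁻¹ (nextV^[n] z) / rayResist β⁻¹ z else 0) := by
    intro w hw
    by_cases h1 : w = nextV^[n + 2] z
    · have h2 : ¬ w = nextV^[n] z := h1 ▸ hne'.symm
      rw [if_pos h1, if_neg h2, h1, hva]
      ring
    by_cases h2 : w = nextV^[n] z
    · rw [if_neg h1, if_pos h2, h2, hvb]
      ring
    rw [if_neg h1, if_neg h2]
    have : voltage β⁻¹ z w = voltage β⁻¹ z (nextV^[n + 1] z) := by
      rcases nextV_of_mem (mem_nbrsFinset.1 hw) with h3 | h3
      · exact absurd (h3.symm.trans (Function.iterate_succ_apply' _ _ _).symm) h1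
      · have hoff : ∀ j, w ≠ nextV^[j] z := by
          rintro j rfl
          rw [← Function.iterate_succ_apply' nextV j z] at h3
          have := iterate_injective h0 hs h3
          exact h2 (by rw [show j = n by omega])
        rw [← h3, voltage, voltage, mergeIndex_nextV hoff]
    rw [this]
    ring
  rw [Finset.sum_congr rfl hterm, Finset.sum_add_distrib, Finset.sum_sub_distrib,
    Finset.sum_ite_eq', Finset.sum_ite_eq', if_pos ha, if_pos hb, ← Finset.sum_mul, hsum, hk]
  exact le_of_eq (by ring)

lemma voltage_first_step {β : ℝ} (hβ : 1 < β) {z : V} (hr : HasRight z)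
    (hs : Summable fun n => resist β⁻¹ (nextV^[n] z))
    (hT : rayResist β⁻¹ z ≤ 2 / (1 - β⁻¹) * resist β⁻¹ z) :
    ∑' w, ENNReal.ofReal (transProb β xiEdges z w) * ENNReal.ofReal (voltage β⁻¹ z w) ≤
      ENNReal.ofReal (1 - (β - 1) / (2 * (3 + β))) := by
  have hβ0 : 0 < β := by linarith
  have h0 : 0 < β⁻¹ := by positivity
  have hne : (nbrs z).Nonempty := ⟨_, hr⟩
  have hmem : ((z.1 + 1, z.2) : V) ∈ nbrsFinset z := mem_nbrsFinset.2 hr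
  rw [tsum_transProb_mul hβ hne (voltage_nonneg h0 z)]
  refine ENNReal.ofReal_le_ofReal ?_
  have hTpos := rayResist_pos h0 hs
  have hv1 : voltage β⁻¹ z (z.1 + 1, z.2) = 1 - resist β⁻¹ z / rayResist β⁻¹ z := by
    have h := voltage_iterate_succ h0 hs 0
    simp only [Function.iterate_zero, id, zero_add, Function.iterate_one, hr.nextV_eq,
      voltage_self h0 hs] at h
    exact h
  have hratio : (β - 1) / (2 * β) ≤ resist β⁻¹ z / rayResist β⁻¹ z := by
    rw [le_div_iff₀ hTpos]
    have hpos : 0 ≤ (β - 1) / (2 * β) := div_nonneg (by linarith) (by linarith)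
    refine (mul_le_mul_of_nonneg_left hT hpos).trans (le_of_eq ?_)
    have h1 : β - 1 ≠ 0 := by linarith
    field_simp
  have hp : β / (β + 3) ≤ transProb β xiEdges z (z.1 + 1, z.2) := by
    rw [transProb_right hr]
    have h4 : ((nbrs z).ncard : ℝ) ≤ 4 := by exact_mod_cast ncard_nbrs_le z
    have := (nbrs z).ncard.cast_nonneg (α := ℝ)
    gcongr <;> linarith
  have hsum := sum_transProb hβ hne
  rw [← Finset.add_sum_erase _ _ hmem] at hsum ⊢
  have hrest : ∑ w ∈ (nbrsFinset z).erase (z.1 + 1, z.2),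
      transProb β xiEdges z w * voltage β⁻¹ z w ≤
      ∑ w ∈ (nbrsFinset z).erase (z.1 + 1, z.2), transProb β xiEdges z w :=
    Finset.sum_le_sum fun w _ =>
      mul_le_of_le_one_right (transProb_nonneg hβ _ _ _) (voltage_le_one h0 hs w)
  have hprod : β / (β + 3) * ((β - 1) / (2 * β)) ≤
      transProb β xiEdges z (z.1 + 1, z.2) * (resist β⁻¹ z / rayResist β⁻¹ z) :=
    mul_le_mul hp hratio (div_nonneg (by linarith) (by linarith)) (transProb_nonneg hβ _ _ _)
  have hc : β / (β + 3) * ((β - 1) / (2 * β)) = (β - 1) / (2 * (3 + β)) := by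
    field_simp
    ring
  rw [hc] at hprod
  rw [hv1]
  linarith

end Superharmonic

section Walk

/-- The trajectory up to time `n`. -/
def history (n : ℕ) (ω : ℕ → V) : Fin (n + 1) → V := fun i => ω i

lemma measurable_history (n : ℕ) : Measurable (history n) :=
  measurable_pi_lambda _ fun i => measurable_pi_apply (i : ℕ)

lemma IsWalkLaw.measure_start_ne {β : ℝ} {G : Set (Sym2 V)} {z : V} {μ : Measure (ℕ → V)}
    (hμ : IsWalkLaw β G z μ) : μ {ω | ω 0 ≠ z} = 0 := by
  have := hμ.1
  have h := hμ.2 0 (fun _ => z) rfl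
  simp only [Nat.le_zero, forall_eq, Finset.range_zero, Finset.prod_empty,
    ENNReal.ofReal_one] at h
  have hm : MeasurableSet {ω : ℕ → V | ω 0 = z} :=
    measurableSet_eq_fun (measurable_pi_apply 0) measurable_const
  exact (prob_compl_eq_zero_iff hm).2 h

/-- The Markov property on cylinders. -/
lemma IsWalkLaw.measure_history_next {β : ℝ} (hβ : 1 < β) {G : Set (Sym2 V)} {z : V}
    {μ : Measure (ℕ → V)} (hμ : IsWalkLaw β G z μ) (n : ℕ) (a : Fin (n + 1) → V) (w : V) :
    μ {ω | history n ω = a ∧ ω (n + 1) = w} =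
      μ {ω | history n ω = a} * ENNReal.ofReal (transProb β G (a (Fin.last n)) w) := by
  by_cases ha : a 0 = z
  · set f : ℕ → V := fun i => if h : i < n + 1 then a ⟨i, h⟩ else w with hf
    have hfa : ∀ i (h : i < n + 1), f i = a ⟨i, h⟩ := fun i h => dif_pos h
    have hfw : f (n + 1) = w := dif_neg (lt_irrefl _)
    have hf0 : f 0 = z := (hfa 0 (Nat.succ_pos n)).trans ha
    have e1 : ∀ ω : ℕ → V, history n ω = a ↔ ∀ i ≤ n, ω i = f i := by
      intro ω
      rw [funext_iff, Fin.forall_iff]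
      refine forall_congr' fun i => ⟨fun h hi => ?_, fun h hi => ?_⟩
      · rw [hfa i (Nat.lt_succ_of_le hi)]
        exact h _
      · rw [← hfa i hi]
        exact h (Nat.le_of_lt_succ hi)
    have e2 : {ω | history n ω = a ∧ ω (n + 1) = w} = {ω | ∀ i ≤ n + 1, ω i = f i} := by
      ext ω
      simp only [Set.mem_ofPred_eq, e1]
      constructor
      · rintro ⟨h, h'⟩ i hi
        rcases hi.lt_or_eq with hlt | rfl
        · exact h i (Nat.le_of_lt_succ hlt)
        · rw [h', hfw]
      · exact fun h => ⟨fun i hi => h i (hi.trans n.le_succ), (h _ le_rfl).trans hfw⟩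
    rw [e2, hμ.2 (n + 1) f hf0, Finset.prod_range_succ, ENNReal.ofReal_mul, ← hμ.2 n f hf0, hfw,
      hfa n (Nat.lt_succ_self n)]
    · simp only [e1]
      rfl
    · exact Finset.prod_nonneg fun i _ => transProb_nonneg hβ _ _ _
  · have hnull : μ {ω | history n ω = a} = 0 :=
      measure_mono_null (fun ω (h : history n ω = a) h0 => ha (h ▸ h0)) hμ.measure_start_ne
    rw [hnull, zero_mul]
    exact measure_mono_null (fun ω h => h.1) hnull

lemma IsWalkLaw.lintegral_next_le {β : ℝ} (hβ : 1 < β) {G : Set (Sym2 V)} {z : V}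
    {μ : Measure (ℕ → V)} (hμ : IsWalkLaw β G z μ) (n : ℕ) (S : Set (Fin (n + 1) → V))
    (g h : V → ℝ≥0∞)
    (hgh : ∀ a ∈ S, a 0 = z →
      ∑' w, ENNReal.ofReal (transProb β G (a (Fin.last n)) w) * g w ≤ h (a (Fin.last n))) :
    ∫⁻ ω in history n ⁻¹' S, g (ω (n + 1)) ∂μ ≤ ∫⁻ ω in history n ⁻¹' S, h (ω n) ∂μ := by
  have hS : MeasurableSet (history n ⁻¹' S) := measurable_history n S.to_countable.measurableSet
  have hτ : Measurable fun ω : ℕ → V => (history n ω, ω (n + 1)) :=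
    (measurable_history n).prodMk (measurable_pi_apply _)
  have hl : ∫⁻ ω in history n ⁻¹' S, g (ω (n + 1)) ∂μ = ∑' a, S.indicator
      (fun a => μ {ω | history n ω = a} *
        ∑' w, ENNReal.ofReal (transProb β G (a (Fin.last n)) w) * g w) a := by
    rw [← lintegral_indicator hS]
    have h1 := lintegral_map (μ := μ)
      (f := fun p : (Fin (n + 1) → V) × V => S.indicator (fun _ => g p.2) p.1)
      (measurable_of_countable _) hτ
    refine (Eq.trans rfl h1.symm).trans ?_
    rw [lintegral_countable', ENNReal.tsum_prod']
    refine tsum_congr fun a => ?_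
    by_cases ha : a ∈ S
    · simp only [Set.indicator_of_mem ha]
      rw [← ENNReal.tsum_mul_left]
      refine tsum_congr fun w => ?_
      rw [Measure.map_apply hτ (measurableSet_singleton _)]
      have : (fun ω : ℕ → V => (history n ω, ω (n + 1))) ⁻¹' {(a, w)} =
          {ω | history n ω = a ∧ ω (n + 1) = w} := by
        ext ω
        simp [Prod.ext_iff]
      rw [this, hμ.measure_history_next hβ]
      ring
    · simp only [Set.indicator_of_notMem ha, zero_mul, tsum_zero]
  have hr : ∫⁻ ω in history n ⁻¹' S, h (ω n) ∂μ = ∑' a, S.indicator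
      (fun a => μ {ω | history n ω = a} * h (a (Fin.last n))) a := by
    rw [← lintegral_indicator hS]
    have h1 : ∀ ω : ℕ → V, (history n ⁻¹' S).indicator (fun ω => h (ω n)) ω =
        S.indicator (fun a => h (a (Fin.last n))) (history n ω) := fun ω => rfl
    rw [lintegral_congr h1, ← lintegral_map (μ := μ) (measurable_of_countable _)
      (measurable_history n), lintegral_countable']
    refine tsum_congr fun a => ?_
    rw [Measure.map_apply (measurable_history n) (measurableSet_singleton _)]
    by_cases ha : a ∈ S
    · simp only [Set.indicator_of_mem ha]
      rw [mul_comm]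
      rfl
    · simp only [Set.indicator_of_notMem ha, zero_mul]
  rw [hl, hr]
  refine ENNReal.tsum_le_tsum fun a => ?_
  by_cases ha : a ∈ S
  · simp only [Set.indicator_of_mem ha]
    by_cases h0 : a 0 = z
    · gcongr
      exact hgh a ha h0
    · have hnull : μ {ω | history n ω = a} = 0 :=
        measure_mono_null (fun ω (h : history n ω = a) h' => h0 (h ▸ h')) hμ.measure_start_ne
      rw [hnull, zero_mul, zero_mul]
  · simp only [Set.indicator_of_notMem ha, le_refl]

/-- The trajectories that do not return to `z` up to time `n`. -/
def noReturn (z : V) (n : ℕ) : Set (ℕ → V) := {ω | ∀ t, 1 ≤ t → t ≤ n → ω t ≠ z}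

lemma noReturn_eq_preimage (z : V) (n : ℕ) :
    noReturn z n = history n ⁻¹' {a | ∀ i, i ≠ 0 → a i ≠ z} := by
  ext ω
  simp only [noReturn, Set.mem_ofPred_eq, Set.mem_preimage, history]
  constructor
  · intro h i hi
    exact h i (Nat.one_le_iff_ne_zero.2 fun h' => hi (Fin.ext h')) (Nat.le_of_lt_succ i.2)
  · intro h t h1 ht
    exact h ⟨t, Nat.lt_succ_of_le ht⟩ fun h' => by
      have := congrArg Fin.val h'
      simp only [Fin.val_zero] at this
      omega

lemma measurableSet_noReturn (z : V) (n : ℕ) : MeasurableSet (noReturn z n) := by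
  rw [noReturn_eq_preimage]
  exact measurable_history n (Set.to_countable _).measurableSet

lemma noReturn_succ (z : V) (n : ℕ) :
    noReturn z (n + 1) = noReturn z n \ {ω | ω (n + 1) = z} := by
  ext ω
  constructor
  · exact fun h => ⟨fun t h1 ht => h t h1 (ht.trans n.le_succ), h _ (by omega) le_rfl⟩
  · rintro ⟨h, hne⟩ t h1 ht
    rcases ht.lt_or_eq with hlt | rfl
    · exact h t h1 (Nat.le_of_lt_succ hlt)
    · exact hne

/-- A superharmonic function bounds the probability of returning to the starting point. -/
lemma IsWalkLaw.le_measure_no_return {β : ℝ} (hβ : 1 < β) {G : Set (Sym2 V)} {z : V}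
    {μ : Measure (ℕ → V)} (hμ : IsWalkLaw β G z μ) {h : V → ℝ≥0∞} (hz : h z = 1)
    (hsup : ∀ v, v ≠ z → ∑' w, ENNReal.ofReal (transProb β G v w) * h w ≤ h v)
    {c : ℝ} (hc0 : 0 ≤ c) (hc1 : c ≤ 1)
    (hfirst : ∑' w, ENNReal.ofReal (transProb β G z w) * h w ≤ ENNReal.ofReal (1 - c)) :
    ENNReal.ofReal c ≤ μ {ω | ∀ t : ℕ, 1 ≤ t → ω t ≠ z} := by
  have := hμ.1
  have hJ : ∀ n, ∫⁻ ω in noReturn z n, h (ω (n + 1)) ∂μ + μ (noReturn z n)ᶜ ≤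
      ENNReal.ofReal (1 - c) := by
    intro n
    induction n with
    | zero =>
      have h0 : noReturn z 0 = Set.univ := by
        ext ω
        simp only [noReturn, Set.mem_ofPred_eq, Set.mem_univ, iff_true]
        intro t h1 ht
        omega
      have hle := hμ.lintegral_next_le hβ 0 {a | ∀ i, i ≠ 0 → a i ≠ z} h
        (fun _ => ENNReal.ofReal (1 - c)) fun a _ ha => by
          rw [show Fin.last 0 = 0 from rfl, ha]
          exact hfirst
      rw [← noReturn_eq_preimage, h0] at hle
      rw [h0, Set.compl_univ, measure_empty, add_zero]
      simpa using hle
    | succ n ih =>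
      refine le_trans ?_ ih
      have hA : MeasurableSet {ω : ℕ → V | ω (n + 1) = z} :=
        measurableSet_eq_fun (measurable_pi_apply (n + 1)) measurable_const
      have hle := hμ.lintegral_next_le hβ (n + 1) {a | ∀ i, i ≠ 0 → a i ≠ z} h h
        fun a ha _ => hsup _ (ha _ (Fin.last_pos).ne')
      rw [← noReturn_eq_preimage] at hle
      have hhit : ∫⁻ ω in noReturn z n ∩ {ω | ω (n + 1) = z}, h (ω (n + 1)) ∂μ =
          μ (noReturn z n ∩ {ω | ω (n + 1) = z}) := by
        rw [setLIntegral_congr_fun (g := fun _ => 1) ((measurableSet_noReturn z n).inter hA)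
          (fun ω hω => by
            have : ω (n + 1) = z := hω.2
            simp only [this, hz]), setLIntegral_one]
      have hcompl : (noReturn z (n + 1))ᶜ ⊆
          (noReturn z n)ᶜ ∪ (noReturn z n ∩ {ω | ω (n + 1) = z}) := by
        intro ω hω
        by_cases h1 : ω ∈ noReturn z n
        · refine .inr ⟨h1, ?_⟩
          by_contra h2
          exact hω (noReturn_succ z n ▸ ⟨h1, h2⟩)
        · exact .inl h1
      rw [← lintegral_inter_add_sdiff _ (noReturn z n) hA, hhit, ← noReturn_succ]
      calc _ ≤ ∫⁻ ω in noReturn z (n + 1), h (ω (n + 1)) ∂μ +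
            (μ (noReturn z n)ᶜ + μ (noReturn z n ∩ {ω | ω (n + 1) = z})) :=
            add_le_add hle ((measure_mono hcompl).trans (measure_union_le _ _))
        _ = _ := by ring
  have hlow : ∀ n, ENNReal.ofReal c ≤ μ (noReturn z n) := by
    intro n
    have h1 : μ (noReturn z n)ᶜ ≤ ENNReal.ofReal (1 - c) := le_add_self.trans (hJ n)
    have h2 : μ (noReturn z n) + μ (noReturn z n)ᶜ = 1 :=
      prob_add_prob_compl (measurableSet_noReturn z n)
    have h3 : ENNReal.ofReal c + ENNReal.ofReal (1 - c) = 1 := by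
      rw [← ENNReal.ofReal_add hc0 (sub_nonneg.2 hc1), add_sub_cancel, ENNReal.ofReal_one]
    refine (ENNReal.add_le_add_iff_right (ENNReal.ofReal_ne_top (r := 1 - c))).1 ?_
    rw [h3, ← h2]
    gcongr
  have hinter : {ω : ℕ → V | ∀ t : ℕ, 1 ≤ t → ω t ≠ z} = ⋂ n, noReturn z n := by
    ext ω
    simp only [Set.mem_iInter]
    exact ⟨fun h n t h1 _ => h t h1, fun h t h1 => h t t h1 le_rfl⟩
  have hanti : Antitone (noReturn z) := fun m n hmn ω hω t h1 ht => hω t h1 (ht.trans hmn)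
  rw [hinter]
  exact ge_of_tendsto' (tendsto_measure_iInter_atTop
    (fun n => (measurableSet_noReturn z n).nullMeasurableSet) hanti
    ⟨0, measure_ne_top μ _⟩) hlow

end Walk

/-- Lemma 4.3. The β-biased random walk on ξ started at a vertex `z` on the main part of an
order-`k` branch lying at least `3·2^{k-1}` steps to the left of the corner never returns
to `z` with probability at least `(β-1)/(2(3+β))`. -/
theorem escape_probability_on_fractal (β : ℝ) (hβ : 1 < β) (k : ℕ) (hk : 1 ≤ k)
    (l x : ℤ) (hl : Odd l) (hx : IsTip k x) (z : V) (hz : OnMainPart k l x z)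
    (hleft : z.1 ≤ x + bF k - 1 - 3 * 2 ^ (k - 1))
    (μ : Measure (ℕ → V)) (hμ : IsWalkLaw β xiEdges z μ) :
    ENNReal.ofReal ((β - 1) / (2 * (3 + β))) ≤
      μ {ω | ∀ t : ℕ, 1 ≤ t → ω t ≠ z} := by
  have hβ0 : 0 < β := by linarith
  have h0 : 0 < β⁻¹ := by positivity
  obtain ⟨hr, hf, hs, hT⟩ := ray_of_onMainPart h0 (inv_lt_one_of_one_lt₀ hβ) hk hl hx hz hleft
  refine hμ.le_measure_no_return hβ (h := fun v => ENNReal.ofReal (voltage β⁻¹ z v)) ?_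
    (fun v hv => voltage_superharmonic hβ hf hs hv) (div_nonneg (by linarith) (by linarith)) ?_
    (voltage_first_step hβ hr hs hT)
  · simp only [voltage_self h0 hs, ENNReal.ofReal_one]
  · rw [div_le_one (by linarith)]
    linarith

end
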